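/- Fix z₁ ∈ ℂ, z₂, z₃ ∈ ℂ∖{0} and real numbers a, b₂, b₃, c₂₂, c₂₃, c₃₃. Define the 3×3 complex matrices M := [[1, i·conj(z₁)/conj(z₂), i·conj(z₁)/conj(z₃)], [−i·z₁/z₂, |z₁|²/|z₂|², |z₁|²/(z₂·conj(z₃))], [−i·z₁/z₃, |z₁|²/(conj(z₂)·z₃), |z₁|²/|z₃|²]] and N, where N has first row and first column zero and N₂₂ = (a+c₂₂)/|z₂|², N₂₃ = (a+c₂₃+i(b₂−b₃))/(z₂·conj(z₃)), N₃₂ = (a+c₂₃+i(b₃−b₂))/(conj(z₂)·z₃), N₃₃ = (a+c₃₃)/|z₃|². Then the Hermitian matrix M+N is positive semidefinite (i.e., the quadratic form u ↦ uᵗ(M+N)·conj(u) is nonnegative on ℂ³) if and only if the 2×2 Hermitian matrix C := [[a+c₂₂, a+c₂₃+i(b₂−b₃)], [a+c₂₃+i(b₃−b₂), a+c₃₃]] is positive semidefinite. -/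

import Mathlib

open Complex ComplexOrder ComplexConjugate Matrix

/-- The complex Hessian factor `M` of `e^{arg(z₂z₃)²}|z₁|²`. -/
noncomputable def Mmat (z₁ z₂ z₃ : ℂ) : Matrix (Fin 3) (Fin 3) ℂ :=
  !![1, Complex.I * conj z₁ / conj z₂, Complex.I * conj z₁ / conj z₃;
     -Complex.I * z₁ / z₂, ((‖z₁‖ : ℂ)) ^ 2 / ((‖z₂‖ : ℂ)) ^ 2,
       ((‖z₁‖ : ℂ)) ^ 2 / (z₂ * conj z₃);
     -Complex.I * z₁ / z₃, ((‖z₁‖ : ℂ)) ^ 2 / (conj z₂ * z₃),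
       ((‖z₁‖ : ℂ)) ^ 2 / ((‖z₃‖ : ℂ)) ^ 2]

/-- The complex Hessian factor `N` of `e^{arg(z₂z₃)²}η(log|z₂|²,log|z₃|²)`. -/
noncomputable def Nmat (z₂ z₃ : ℂ) (a b₂ b₃ c₂₂ c₂₃ c₃₃ : ℝ) : Matrix (Fin 3) (Fin 3) ℂ :=
  !![0, 0, 0;
     0, ((a : ℂ) + (c₂₂ : ℂ)) / ((‖z₂‖ : ℂ)) ^ 2,
       ((a : ℂ) + (c₂₃ : ℂ) + Complex.I * ((b₂ : ℂ) - (b₃ : ℂ))) / (z₂ * conj z₃);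
     0, ((a : ℂ) + (c₂₃ : ℂ) + Complex.I * ((b₃ : ℂ) - (b₂ : ℂ))) / (conj z₂ * z₃),
       ((a : ℂ) + (c₃₃ : ℂ)) / ((‖z₃‖ : ℂ)) ^ 2]

/-- The reduced `2×2` matrix `C`. -/
noncomputable def Cmat (a b₂ b₃ c₂₂ c₂₃ c₃₃ : ℝ) : Matrix (Fin 2) (Fin 2) ℂ :=
  !![(a : ℂ) + (c₂₂ : ℂ), (a : ℂ) + (c₂₃ : ℂ) + Complex.I * ((b₂ : ℂ) - (b₃ : ℂ));
     (a : ℂ) + (c₂₃ : ℂ) + Complex.I * ((b₃ : ℂ) - (b₂ : ℂ)), (a : ℂ) + (c₃₃ : ℂ)]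

lemma hessian_key (z₁ z₂ z₃ : ℂ) (h2 : z₂ ≠ 0) (h3 : z₃ ≠ 0)
    (a b₂ b₃ c₂₂ c₂₃ c₃₃ : ℝ) (u : Fin 3 → ℂ) :
    u ⬝ᵥ (Mmat z₁ z₂ z₃ + Nmat z₂ z₃ a b₂ b₃ c₂₂ c₂₃ c₃₃).mulVec (fun i => conj (u i)) =
      (u 0 - Complex.I * z₁ / z₂ * u 1 - Complex.I * z₁ / z₃ * u 2) *
        conj (u 0 - Complex.I * z₁ / z₂ * u 1 - Complex.I * z₁ / z₃ * u 2) +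
      (![u 1 / z₂, u 2 / z₃] : Fin 2 → ℂ) ⬝ᵥ (Cmat a b₂ b₃ c₂₂ c₂₃ c₃₃).mulVec
        (fun i => conj ((![u 1 / z₂, u 2 / z₃] : Fin 2 → ℂ) i)) := by
  have h2' : conj z₂ ≠ 0 := by simpa using h2
  have h3' : conj z₃ ≠ 0 := by simpa using h3
  simp only [Mmat, Nmat, Cmat, ← Complex.mul_conj', dotProduct, mulVec, Fin.sum_univ_three,
    Fin.sum_univ_two, Matrix.add_apply, Matrix.of_apply, Matrix.cons_val, Matrix.cons_val_zero,
    Matrix.cons_val_one, map_sub, map_mul, map_div₀, Complex.conj_I]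
  field_simp
  ring_nf
  simp only [Complex.I_sq]
  ring

/-- The Hermitian matrix `M + N` is positive semidefinite (its quadratic form
`u ↦ uᵗ(M+N)·conj u` is nonnegative on `ℂ³`) if and only if the `2×2` Hermitian
matrix `C` is positive semidefinite. -/
theorem hessian_posSemidef_iff (z₁ z₂ z₃ : ℂ) (h2 : z₂ ≠ 0) (h3 : z₃ ≠ 0)
    (a b₂ b₃ c₂₂ c₂₃ c₃₃ : ℝ) :
    (∀ u : Fin 3 → ℂ, 0 ≤ u ⬝ᵥ (Mmat z₁ z₂ z₃ + Nmat z₂ z₃ a b₂ b₃ c₂₂ c₂₃ c₃₃).mulVec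
        (fun i => conj (u i))) ↔
      (∀ v : Fin 2 → ℂ, 0 ≤ v ⬝ᵥ (Cmat a b₂ b₃ c₂₂ c₂₃ c₃₃).mulVec (fun i => conj (v i))) := by
  constructor
  · intro h v
    have := h ![Complex.I * z₁ * v 0 + Complex.I * z₁ * v 1, z₂ * v 0, z₃ * v 1]
    rw [hessian_key z₁ z₂ z₃ h2 h3] at this
    have e0 : Complex.I * z₁ * v 0 + Complex.I * z₁ * v 1 - Complex.I * z₁ / z₂ * (z₂ * v 0)
        - Complex.I * z₁ / z₃ * (z₃ * v 1) = 0 := by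
      field_simp
      ring
    have ev : (![z₂ * v 0 / z₂, z₃ * v 1 / z₃] : Fin 2 → ℂ) = v := by
      ext i
      fin_cases i <;> simp [h2, h3]
    simp only [Matrix.cons_val, Matrix.cons_val_zero, Matrix.cons_val_one] at this
    rw [e0, ev, zero_mul, zero_add] at this
    exact this
  · intro h u
    rw [hessian_key z₁ z₂ z₃ h2 h3]
    refine add_nonneg ?_ (h _)
    rw [Complex.mul_conj]
    exact_mod_cast Complex.normSq_nonneg _
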